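/- (Theorem A(a)) Fix real numbers 0 < ρ_m < ρ_0 < ρ_M ≤ +∞. There exists a constant C = C_{ρ_m,ρ_0} > 0, depending only on ρ_m and ρ_0, with the following property: for every admissible data (𝒰, a, V, u, U, γ, H) in which u is a weak stationary solution density, U is a Lyapunov function in 𝒰 with respect to ℒ with Lyapunov constant γ, essential lower bound ρ_m and essential upper bound ρ_M, and H is an upper sandwich function for U, one has μ(𝒰 \ Ω_{ρ_0}) ≤ γ^{-1} · C · (sup_{t ∈ (ρ_m,ρ_0)} H(t)) · μ(Ω_{ρ_0} \ Ω_{ρ_m}). -/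

import Mathlib

open MeasureTheory

noncomputable section

/-- Euclidean space ℝⁿ. -/
abbrev Eucl (n : ℕ) : Type := EuclideanSpace ℝ (Fin n)

/-- First-order partial derivative `∂ᵢ f`. -/
def pd {n : ℕ} (f : Eucl n → ℝ) (i : Fin n) (x : Eucl n) : ℝ :=
  fderiv ℝ f x (EuclideanSpace.single i 1)

/-- Second-order partial derivative `∂²ᵢⱼ f`. -/
def pd2 {n : ℕ} (f : Eucl n → ℝ) (i j : Fin n) (x : Eucl n) : ℝ :=
  fderiv ℝ (fun y => fderiv ℝ f y (EuclideanSpace.single j 1)) x (EuclideanSpace.single i 1)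

/-- The adjoint Fokker–Planck operator `ℒf = aⁱʲ ∂²ᵢⱼ f + Vⁱ ∂ᵢ f`. -/
def Lop {n : ℕ} (a : Eucl n → Matrix (Fin n) (Fin n) ℝ)
    (V : Eucl n → Fin n → ℝ) (f : Eucl n → ℝ) (x : Eucl n) : ℝ :=
  (∑ i, ∑ j, a x i j * pd2 f i j x) + ∑ i, V x i * pd f i x

/-- The quadratic form `⟨a(x) ∇f(x), ∇f(x)⟩ = ∑ᵢⱼ aⁱʲ ∂ᵢf ∂ⱼf`. -/
def aQuad {n : ℕ} (a : Eucl n → Matrix (Fin n) (Fin n) ℝ)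
    (f : Eucl n → ℝ) (x : Eucl n) : ℝ :=
  ∑ i, ∑ j, a x i j * pd f i x * pd f j x

open Set Filter Topology Metric Function
open scoped Convolution

section Mollification

variable {n : ℕ}

lemma continuous_pd {f : Eucl n → ℝ} (hf : ContDiff ℝ 1 f) (i : Fin n) :
    Continuous (pd f i) :=
  (hf.continuous_fderiv one_ne_zero).clm_apply continuous_const

lemma contDiff_pd {f : Eucl n → ℝ} (hf : ContDiff ℝ 2 f) (i : Fin n) :
    ContDiff ℝ 1 (pd f i) :=
  (hf.fderiv_right (m := 1) (by norm_num)).clm_apply contDiff_const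

lemma support_pd_subset (f : Eucl n → ℝ) (i : Fin n) : support (pd f i) ⊆ tsupport f := by
  intro x hx
  by_contra hxf
  exact hx (by simp [pd, fderiv_of_notMem_tsupport ℝ hxf])

lemma tsupport_pd_subset (f : Eucl n → ℝ) (i : Fin n) : tsupport (pd f i) ⊆ tsupport f :=
  closure_minimal (support_pd_subset f i) (isClosed_tsupport f)

lemma hasCompactSupport_pd {f : Eucl n → ℝ} (hf : HasCompactSupport f) (i : Fin n) :
    HasCompactSupport (pd f i) :=
  hf.of_isClosed_subset (isClosed_tsupport _) (tsupport_pd_subset f i)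

lemma pd2_eq_pd_pd (f : Eucl n → ℝ) (i j : Fin n) : pd2 f i j = pd (pd f j) i := rfl

/-- The convolution of `h` with the normalized bump function `φ`. -/
def mollify (φ : ContDiffBump (0 : Eucl n)) (h : Eucl n → ℝ) : Eucl n → ℝ :=
  φ.normed volume ⋆[ContinuousLinearMap.lsmul ℝ ℝ, volume] h

lemma locallyIntegrable_normed (φ : ContDiffBump (0 : Eucl n)) :
    LocallyIntegrable (φ.normed volume) (volume : Measure (Eucl n)) :=
  φ.continuous_normed.locallyIntegrable

lemma pd_mollify (φ : ContDiffBump (0 : Eucl n)) {h : Eucl n → ℝ} (hh : ContDiff ℝ 1 h)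
    (hc : HasCompactSupport h) (i : Fin n) : pd (mollify φ h) i = mollify φ (pd h i) := by
  funext x
  have hd := hc.hasFDerivAt_convolution_right (ContinuousLinearMap.lsmul ℝ ℝ)
    (locallyIntegrable_normed φ) hh x
  rw [pd, mollify, hd.fderiv, convolution_precompR_apply _ (locallyIntegrable_normed φ)
    (hc.fderiv ℝ) (hh.continuous_fderiv one_ne_zero)]
  rfl

lemma exists_pos_forall_mollify_sub_le {h : Eucl n → ℝ} (hh : Continuous h)
    (hc : HasCompactSupport h) {ε : ℝ} (hε : 0 < ε) :
    ∃ r > 0, ∀ φ : ContDiffBump (0 : Eucl n), φ.rOut ≤ r → ∀ x, |mollify φ h x - h x| ≤ ε := by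
  obtain ⟨r, hr, H⟩ := Metric.uniformContinuous_iff.1 (hc.uniformContinuous_of_continuous hh) ε hε
  refine ⟨r, hr, fun φ hφ x => ?_⟩
  exact φ.dist_normed_convolution_le hh.aestronglyMeasurable
    fun y hy => (H (lt_of_lt_of_le hy hφ)).le

lemma tsupport_mollify_subset (φ : ContDiffBump (0 : Eucl n)) (h : Eucl n → ℝ) :
    tsupport (mollify φ h) ⊆ cthickening φ.rOut (tsupport h) := by
  refine closure_minimal ?_ isClosed_cthickening
  refine (support_convolution_subset_swap _).trans ?_
  rintro _ ⟨y, hy, z, hz, rfl⟩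
  rw [φ.support_normed_eq, mem_ball_zero_iff] at hz
  exact mem_cthickening_of_dist_le _ y _ _ (subset_tsupport h hy) (by simpa using hz.le)

lemma exists_contDiff_approx {f : Eucl n → ℝ} (hf : ContDiff ℝ 2 f) (hc : HasCompactSupport f)
    {δ ε : ℝ} (hδ : 0 < δ) (hε : 0 < ε) :
    ∃ g : Eucl n → ℝ, ContDiff ℝ (⊤ : ℕ∞) g ∧ tsupport g ⊆ cthickening δ (tsupport f) ∧
      (∀ i x, |pd g i x - pd f i x| ≤ ε) ∧ ∀ i j x, |pd2 g i j x - pd2 f i j x| ≤ ε := by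
  have hf1 : ContDiff ℝ 1 f := hf.of_le (by norm_num)
  have h1 i := exists_pos_forall_mollify_sub_le (continuous_pd hf1 i)
    (hasCompactSupport_pd hc i) hε
  have h2 i j := exists_pos_forall_mollify_sub_le (continuous_pd (contDiff_pd hf j) i)
    (hasCompactSupport_pd (hasCompactSupport_pd hc j) i) hε
  choose r1 hr1 H1 using h1
  choose r2 hr2 H2 using h2
  obtain ⟨r, hr, hrδ, hrr1, hrr2⟩ :
      ∃ r > 0, r ≤ δ ∧ (∀ i, r ≤ r1 i) ∧ ∀ i j, r ≤ r2 i j := by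
    have e1 : ∀ᶠ r in 𝓝[>] (0 : ℝ), ∀ i, r ≤ r1 i :=
      eventually_all.2 fun i => mem_nhdsWithin_of_mem_nhds (Iic_mem_nhds (hr1 i))
    have e2 : ∀ᶠ r in 𝓝[>] (0 : ℝ), ∀ i j, r ≤ r2 i j :=
      eventually_all.2 fun i => eventually_all.2 fun j =>
        mem_nhdsWithin_of_mem_nhds (Iic_mem_nhds (hr2 i j))
    have e3 : ∀ᶠ r in 𝓝[>] (0 : ℝ), r ≤ δ := mem_nhdsWithin_of_mem_nhds (Iic_mem_nhds hδ)
    obtain ⟨r, ⟨⟨h, h'⟩, h''⟩, h0⟩ := (((e1.and e2).and e3).and self_mem_nhdsWithin).exists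
    exact ⟨r, h0, h'', h, h'⟩
  let φ : ContDiffBump (0 : Eucl n) := ⟨r / 2, r, half_pos hr, half_lt_self hr⟩
  refine ⟨mollify φ f, ?_, ?_, fun i x => ?_, fun i j x => ?_⟩
  · exact φ.hasCompactSupport_normed.contDiff_convolution_left _ φ.contDiff_normed
      hf.continuous.locallyIntegrable
  · exact (tsupport_mollify_subset φ f).trans (cthickening_mono hrδ _)
  · rw [pd_mollify φ hf1 hc]
    exact H1 i φ (hrr1 i) x
  · rw [pd2_eq_pd_pd, pd2_eq_pd_pd, pd_mollify φ hf1 hc, pd_mollify φ (contDiff_pd hf j)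
      (hasCompactSupport_pd hc j)]
    exact H2 i j φ (hrr2 i j) x

end Mollification

section WeakSolution

variable {n : ℕ}

lemma Lop_eq_zero_of_notMem_tsupport (a : Eucl n → Matrix (Fin n) (Fin n) ℝ)
    (V : Eucl n → Fin n → ℝ) {f : Eucl n → ℝ} {x : Eucl n} (hx : x ∉ tsupport f) :
    Lop a V f x = 0 := by
  have h1 (i) : pd f i x = 0 := notMem_support.1 fun h => hx (support_pd_subset f i h)
  have h2 (i j) : pd2 f i j x = 0 :=
    notMem_support.1 fun h => hx (tsupport_pd_subset f j (support_pd_subset _ i h))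
  simp [Lop, h1, h2]

lemma continuousOn_Lop {a : Eucl n → Matrix (Fin n) (Fin n) ℝ} {V : Eucl n → Fin n → ℝ}
    {s : Set (Eucl n)} (ha : ∀ i j, ContinuousOn (fun x => a x i j) s) (hV : ContinuousOn V s)
    {f : Eucl n → ℝ} (hf : ContDiff ℝ 2 f) : ContinuousOn (Lop a V f) s := by
  refine .add ?_ ?_
  · exact continuousOn_finsetSum _ fun i _ => continuousOn_finsetSum _ fun j _ =>
      (ha i j).mul (continuous_pd (contDiff_pd hf j) i).continuousOn
  · exact continuousOn_finsetSum _ fun i _ => (continuousOn_pi.1 hV i).mul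
      (continuous_pd (hf.of_le (by norm_num)) i).continuousOn

lemma abs_Lop_sub_le (a : Eucl n → Matrix (Fin n) (Fin n) ℝ) (V : Eucl n → Fin n → ℝ)
    {f g : Eucl n → ℝ} {ε : ℝ} {x : Eucl n} (h1 : ∀ i, |pd g i x - pd f i x| ≤ ε)
    (h2 : ∀ i j, |pd2 g i j x - pd2 f i j x| ≤ ε) :
    |Lop a V g x - Lop a V f x| ≤ ((∑ i, ∑ j, |a x i j|) + ∑ i, |V x i|) * ε := by
  have e : Lop a V g x - Lop a V f x =
      (∑ i, ∑ j, a x i j * (pd2 g i j x - pd2 f i j x)) +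
        ∑ i, V x i * (pd g i x - pd f i x) := by
    simp only [Lop, mul_sub, Finset.sum_sub_distrib]
    ring
  rw [e, add_mul, Finset.sum_mul, Finset.sum_mul]
  refine (abs_add_le _ _).trans (add_le_add ?_ ?_)
  · refine (Finset.abs_sum_le_sum_abs _ _).trans (Finset.sum_le_sum fun i _ => ?_)
    rw [Finset.sum_mul]
    refine (Finset.abs_sum_le_sum_abs _ _).trans (Finset.sum_le_sum fun j _ => ?_)
    rw [abs_mul]
    exact mul_le_mul_of_nonneg_left (h2 i j) (abs_nonneg _)
  · refine (Finset.abs_sum_le_sum_abs _ _).trans (Finset.sum_le_sum fun i _ => ?_)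
    rw [abs_mul]
    exact mul_le_mul_of_nonneg_left (h1 i) (abs_nonneg _)

variable {𝒰 : Set (Eucl n)} {a : Eucl n → Matrix (Fin n) (Fin n) ℝ} {V : Eucl n → Fin n → ℝ}
  {u : Eucl n → ℝ}

lemma integrableOn_Lop_mul (ha : ∀ i j, ContinuousOn (fun x => a x i j) 𝒰)
    (hV : ContinuousOn V 𝒰) (hu : ContinuousOn u 𝒰) {f : Eucl n → ℝ} (hf : ContDiff ℝ 2 f)
    (hc : HasCompactSupport f) (hs : tsupport f ⊆ 𝒰) (h𝒰 : MeasurableSet 𝒰) :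
    IntegrableOn (fun x => Lop a V f x * u x) 𝒰 := by
  have h : IntegrableOn (fun x => Lop a V f x * u x) (tsupport f) :=
    (((continuousOn_Lop ha hV hf).mul hu).mono hs).integrableOn_compact hc
  exact h.of_forall_sdiff_eq_zero h𝒰 fun x hx => by
    simp [Lop_eq_zero_of_notMem_tsupport a V hx.2]

/-- The weak formulation extends from smooth to `C²` compactly supported test functions. -/
lemma integral_Lop_mul_eq_zero (h𝒰 : IsOpen 𝒰) (ha : ∀ i j, ContinuousOn (fun x => a x i j) 𝒰)
    (hV : ContinuousOn V 𝒰) (hu : ContinuousOn u 𝒰)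
    (hw : ∀ f : Eucl n → ℝ, ContDiff ℝ (⊤ : ℕ∞) f → HasCompactSupport f →
      tsupport f ⊆ 𝒰 → (∫ x in 𝒰, Lop a V f x * u x) = 0)
    {f : Eucl n → ℝ} (hf : ContDiff ℝ 2 f) (hc : HasCompactSupport f) (hs : tsupport f ⊆ 𝒰) :
    (∫ x in 𝒰, Lop a V f x * u x) = 0 := by
  obtain ⟨δ, hδ, hK𝒰⟩ := IsCompact.exists_cthickening_subset_open hc h𝒰 hs
  set K := cthickening δ (tsupport f)
  have hK : IsCompact K := IsCompact.cthickening hc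
  have hcont : ContinuousOn (fun x => ((∑ i, ∑ j, |a x i j|) + ∑ i, |V x i|) * |u x|) K := by
    refine ContinuousOn.mono (.mul (.add ?_ ?_) hu.abs) hK𝒰
    · exact continuousOn_finsetSum _ fun i _ => continuousOn_finsetSum _ fun j _ => (ha i j).abs
    · exact continuousOn_finsetSum _ fun i _ => (continuousOn_pi.1 hV i).abs
  obtain ⟨B, hB⟩ := hK.bddAbove_image hcont
  have key : ∀ ε > 0, ‖∫ x in 𝒰, Lop a V f x * u x‖ ≤ B * volume.real K * ε := by
    intro ε hε
    obtain ⟨g, hg, hgs, hg1, hg2⟩ := exists_contDiff_approx hf hc hδ hε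
    have hgc : HasCompactSupport g := hK.of_isClosed_subset (isClosed_tsupport g) hgs
    have hg' : ContDiff ℝ 2 g := contDiff_infty.1 hg 2
    have hfi := integrableOn_Lop_mul ha hV hu hf hc hs h𝒰.measurableSet
    have hgi := integrableOn_Lop_mul ha hV hu hg' hgc (hgs.trans hK𝒰) h𝒰.measurableSet
    have e : (∫ x in 𝒰, Lop a V f x * u x) =
        ∫ x in K, (Lop a V f x * u x - Lop a V g x * u x) := by
      rw [← sub_zero (∫ x in 𝒰, Lop a V f x * u x), ← hw g hg hgc (hgs.trans hK𝒰),
        ← integral_sub hfi hgi]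
      refine setIntegral_eq_of_subset_of_forall_sdiff_eq_zero h𝒰.measurableSet hK𝒰 fun x hx => ?_
      rw [Lop_eq_zero_of_notMem_tsupport a V fun h => hx.2 (hgs h),
        Lop_eq_zero_of_notMem_tsupport a V fun h => hx.2 (self_subset_cthickening _ h)]
      simp
    rw [e, mul_right_comm]
    refine norm_setIntegral_le_of_norm_le_const hK.measure_lt_top fun x hx => ?_
    rw [← sub_mul, norm_mul, Real.norm_eq_abs, Real.norm_eq_abs, abs_sub_comm]
    calc _ ≤ _ * |u x| := mul_le_mul_of_nonneg_right
          (abs_Lop_sub_le a V (fun i => hg1 i x) fun i j => hg2 i j x) (abs_nonneg _)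
      _ = ((∑ i, ∑ j, |a x i j|) + ∑ i, |V x i|) * |u x| * ε := by ring
      _ ≤ B * ε := mul_le_mul_of_nonneg_right (hB (mem_image_of_mem _ hx)) hε.le
  have hlim : Tendsto (fun ε : ℝ => B * volume.real K * ε) (𝓝[>] 0) (𝓝 0) := by
    have : Tendsto (fun ε : ℝ => B * volume.real K * ε) (𝓝 0) (𝓝 (B * volume.real K * 0)) :=
      (continuous_const.mul continuous_id).tendsto 0
    rw [mul_zero] at this
    exact this.mono_left nhdsWithin_le_nhds
  exact norm_le_zero_iff.1 (ge_of_tendsto hlim (eventually_mem_nhdsWithin.mono key))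

end WeakSolution

section ChainRule

variable {n : ℕ} {𝒰 : Set (Eucl n)} {U : Eucl n → ℝ}

lemma pd_congr {f g : Eucl n → ℝ} {x : Eucl n} (h : f =ᶠ[𝓝 x] g) (i : Fin n) :
    pd f i x = pd g i x := by
  rw [pd, pd, h.fderiv_eq]

lemma pd_comp {φ : ℝ → ℝ} {φ' : ℝ} {x : Eucl n} (hφ : HasDerivAt φ φ' (U x))
    (hU : DifferentiableAt ℝ U x) (i : Fin n) : pd (fun y => φ (U y)) i x = φ' * pd U i x := by
  have := (hφ.comp_hasFDerivAt x hU.hasFDerivAt).fderiv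
  simp only [Function.comp_def] at this
  simp [pd, this]

lemma pd_mul {f g : Eucl n → ℝ} {x : Eucl n} (hf : DifferentiableAt ℝ f x)
    (hg : DifferentiableAt ℝ g x) (i : Fin n) :
    pd (fun y => f y * g y) i x = f x * pd g i x + g x * pd f i x := by
  simp [pd, fderiv_fun_mul hf hg]

lemma differentiableAt_pd (h𝒰 : IsOpen 𝒰) (hU : ContDiffOn ℝ 2 U 𝒰) {x : Eucl n} (hx : x ∈ 𝒰)
    (i : Fin n) : DifferentiableAt ℝ (pd U i) x := by
  have h : ContDiffAt ℝ 1 (fderiv ℝ U) x :=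
    (hU.contDiffAt (h𝒰.mem_nhds hx)).fderiv_right (by norm_num)
  exact (h.differentiableAt one_ne_zero).clm_apply (differentiableAt_const _)

lemma Lop_comp (h𝒰 : IsOpen 𝒰) (hU : ContDiffOn ℝ 2 U 𝒰)
    (a : Eucl n → Matrix (Fin n) (Fin n) ℝ) (V : Eucl n → Fin n → ℝ) {φ χ χ' : ℝ → ℝ}
    (hφ : ∀ t, HasDerivAt φ (χ t) t) (hχ : ∀ t, HasDerivAt χ (χ' t) t)
    {f : Eucl n → ℝ} (hf : ∀ x ∈ 𝒰, f x = φ (U x)) {x : Eucl n} (hx : x ∈ 𝒰) :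
    Lop a V f x = χ (U x) * Lop a V U x + χ' (U x) * aQuad a U x := by
  have hd : ∀ y ∈ 𝒰, DifferentiableAt ℝ U y := fun y hy =>
    (hU.contDiffAt (h𝒰.mem_nhds hy)).differentiableAt two_ne_zero
  have h1 : ∀ i, ∀ y ∈ 𝒰, pd f i y = χ (U y) * pd U i y := fun i y hy => by
    rw [pd_congr ((h𝒰.mem_nhds hy |> eventually_of_mem) hf) i, pd_comp (hφ _) (hd y hy)]
  have h2 : ∀ i j, pd2 f i j x = χ (U x) * pd2 U i j x + χ' (U x) * (pd U i x * pd U j x) := by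
    intro i j
    rw [pd2_eq_pd_pd, pd_congr (eventually_of_mem (h𝒰.mem_nhds hx) (h1 j)) i,
      pd_mul (f := fun y => χ (U y)) ((hχ (U x)).differentiableAt.comp x (hd x hx)) (differentiableAt_pd h𝒰 hU hx j),
      pd_comp (hχ _) (hd x hx), pd2_eq_pd_pd]
    ring
  simp only [Lop, aQuad, h1 _ x hx, h2, mul_add, Finset.sum_add_distrib, Finset.mul_sum]
  rw [add_right_comm]
  congr 1
  · congr 1
    · exact Finset.sum_congr rfl fun i _ => Finset.sum_congr rfl fun j _ => by ring
    · exact Finset.sum_congr rfl fun i _ => by ring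
  · exact Finset.sum_congr rfl fun i _ => Finset.sum_congr rfl fun j _ => by ring

/-- A function `φ ∘ U`, with `φ` vanishing on `[ρ, ∞)`, extends by zero outside `𝒰` to a
compactly supported function. -/
lemma exists_contDiff_extend (h𝒰 : IsOpen 𝒰) (hU : ContDiffOn ℝ 2 U 𝒰) {ρ : ℝ}
    (hK : IsCompact {x ∈ 𝒰 | U x ≤ ρ}) {φ : ℝ → ℝ} (hφ : ContDiff ℝ 2 φ)
    (hφ0 : ∀ t, ρ ≤ t → φ t = 0) :
    ∃ f : Eucl n → ℝ, ContDiff ℝ 2 f ∧ HasCompactSupport f ∧ tsupport f ⊆ 𝒰 ∧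
      ∀ x ∈ 𝒰, f x = φ (U x) := by
  let f : Eucl n → ℝ := 𝒰.indicator fun x => φ (U x)
  have hf : ∀ x ∈ 𝒰, f x = φ (U x) := fun x hx => indicator_of_mem hx _
  have hzero : ∀ x ∉ {x ∈ 𝒰 | U x ≤ ρ}, f x = 0 := by
    intro x hx
    by_cases hx𝒰 : x ∈ 𝒰
    · rw [hf x hx𝒰]
      exact hφ0 _ (le_of_not_ge fun h => hx ⟨hx𝒰, h⟩)
    · exact indicator_of_notMem hx𝒰 _
  have hs : tsupport f ⊆ {x ∈ 𝒰 | U x ≤ ρ} :=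
    closure_minimal (fun x hx => by_contra fun h => hx (hzero x h)) hK.isClosed
  refine ⟨f, contDiff_iff_contDiffAt.2 fun x => ?_, hK.of_isClosed_subset (isClosed_tsupport f) hs,
    fun x hx => (hs hx).1, hf⟩
  by_cases hx : x ∈ 𝒰
  · exact (hφ.contDiffAt.comp x (hU.contDiffAt (h𝒰.mem_nhds hx))).congr_of_eventuallyEq
      (eventually_of_mem (h𝒰.mem_nhds hx) hf)
  · have h : f =ᶠ[𝓝 x] fun _ => 0 :=
      eventually_of_mem (hK.isClosed.isOpen_compl.mem_nhds fun h => hx h.1) hzero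
    exact contDiffAt_const.congr_of_eventuallyEq h

end ChainRule

section Cutoff

/-- The smooth monotone transition from `0` on `(-∞, a]` to `1` on `[b, ∞)`. -/
def ramp (a b t : ℝ) : ℝ := Real.smoothTransition ((t - a) / (b - a))

variable {a b : ℝ}

lemma contDiff_ramp {k : ℕ∞} : ContDiff ℝ k (ramp a b) :=
  Real.smoothTransition.contDiff.comp ((contDiff_id.sub contDiff_const).div_const _)

lemma differentiable_ramp : Differentiable ℝ (ramp a b) :=
  (contDiff_ramp (k := 1)).differentiable one_ne_zero

lemma ramp_nonneg (t : ℝ) : 0 ≤ ramp a b t := Real.smoothTransition.nonneg _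

lemma ramp_le_one (t : ℝ) : ramp a b t ≤ 1 := Real.smoothTransition.le_one _

lemma ramp_of_le (hab : a < b) {t : ℝ} (ht : t ≤ a) : ramp a b t = 0 :=
  Real.smoothTransition.zero_of_nonpos
    (div_nonpos_of_nonpos_of_nonneg (sub_nonpos.2 ht) (sub_pos.2 hab).le)

lemma ramp_of_ge (hab : a < b) {t : ℝ} (ht : b ≤ t) : ramp a b t = 1 :=
  Real.smoothTransition.one_of_one_le ((one_le_div (sub_pos.2 hab)).2 (by linarith))

lemma monotone_ramp (hab : a < b) : Monotone (ramp a b) := fun s t h =>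
  Real.smoothTransition.monotone
    (div_le_div_of_nonneg_right (by linarith) (sub_pos.2 hab).le)

lemma deriv_ramp_of_le (hab : a < b) {t : ℝ} (ht : t ≤ a) : deriv (ramp a b) t = 0 :=
  IsLocalMin.deriv_eq_zero (Eventually.of_forall fun s => by
    simpa [ramp_of_le hab ht] using ramp_nonneg s)

lemma deriv_ramp_of_ge (hab : a < b) {t : ℝ} (ht : b ≤ t) : deriv (ramp a b) t = 0 :=
  IsLocalMax.deriv_eq_zero (Eventually.of_forall fun s => by
    simpa [ramp_of_ge hab ht] using ramp_le_one s)

lemma exists_deriv_ramp_le : ∃ C > 0, ∀ t ∈ Icc a b, deriv (ramp a b) t ≤ C := by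
  obtain ⟨C, hC⟩ := (isCompact_Icc (a := a) (b := b)).bddAbove_image
    ((contDiff_ramp (k := 1)).continuous_deriv le_rfl).continuousOn
  exact ⟨max C 1, lt_max_of_lt_right one_pos,
    fun t ht => (hC (mem_image_of_mem _ ht)).trans (le_max_left _ _)⟩

/-- Primitive of a bump that rises along `ramp a b`, is constantly `1` up to `c`, and falls to
`0` at `d`. -/
lemma exists_cutoff {a b c d : ℝ} (hab : a < b) (hbc : b ≤ c) (hcd : c < d) :
    ∃ φ χ : ℝ → ℝ, ContDiff ℝ 2 φ ∧ (∀ t, HasDerivAt φ (χ t) t) ∧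
      (∀ t, HasDerivAt χ (deriv χ t) t) ∧ (∀ t, d ≤ t → φ t = 0) ∧ (∀ t, 0 ≤ χ t) ∧
      (∀ t ≤ a, χ t = 0) ∧ (∀ t ∈ Icc b c, χ t = 1) ∧ (∀ t ≤ a, deriv χ t = 0) ∧
      (∀ t ≤ b, deriv χ t = deriv (ramp a b) t) ∧ ∀ t, b ≤ t → deriv χ t ≤ 0 := by
  let χ : ℝ → ℝ := fun t => ramp a b t * (1 - ramp c d t)
  have hχ : ContDiff ℝ 1 χ := contDiff_ramp.mul (contDiff_const.sub contDiff_ramp)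
  have hder (t) : HasDerivAt χ (deriv (ramp a b) t * (1 - ramp c d t) +
      ramp a b t * -deriv (ramp c d) t) t :=
    (differentiable_ramp t).hasDerivAt.mul ((differentiable_ramp t).hasDerivAt.const_sub 1)
  have hφ (t) : HasDerivAt (fun t => ∫ s in d..t, χ s) (χ t) t :=
    intervalIntegral.integral_hasDerivAt_right (hχ.continuous.intervalIntegrable _ _)
      (hχ.continuous.stronglyMeasurableAtFilter _ _) hχ.continuous.continuousAt
  refine ⟨fun t => ∫ s in d..t, χ s, χ, ?_, hφ, fun t => (hder t).differentiableAt.hasDerivAt,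
    fun t ht => ?_, fun t => ?_, fun t ht => ?_, fun t ht => ?_, fun t ht => ?_, fun t ht => ?_,
    fun t ht => ?_⟩
  · rw [show (2 : WithTop ℕ∞) = 1 + 1 by norm_num, contDiff_succ_iff_deriv]
    refine ⟨fun t => (hφ t).differentiableAt, by simp, ?_⟩
    rwa [funext fun t => (hφ t).deriv]
  · refine (intervalIntegral.integral_congr (g := fun _ => 0) fun s hs => ?_).trans (by simp)
    rw [uIcc_of_le ht] at hs
    simp [χ, ramp_of_ge hcd hs.1]
  · exact mul_nonneg (ramp_nonneg t) (sub_nonneg.2 (ramp_le_one t))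
  · simp [χ, ramp_of_le hab ht]
  · simp [χ, ramp_of_ge hab ht.1, ramp_of_le hcd ht.2]
  · simp [(hder t).deriv, ramp_of_le hab ht, deriv_ramp_of_le hab ht]
  · simp [(hder t).deriv, ramp_of_le hcd (ht.trans hbc), deriv_ramp_of_le hcd (ht.trans hbc)]
  · simp [(hder t).deriv, deriv_ramp_of_ge hab ht, ramp_of_ge hab ht,
      (monotone_ramp hcd).deriv_nonneg]

end Cutoff

section TailEstimate

variable {n : ℕ} {𝒰 : Set (Eucl n)} {U : Eucl n → ℝ}

lemma isOpen_sublevel (h𝒰 : IsOpen 𝒰) (hU : ContinuousOn U 𝒰) (ρ : ℝ) :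
    IsOpen {x ∈ 𝒰 | U x < ρ} :=
  hU.isOpen_inter_preimage h𝒰 isOpen_Iio

lemma measurableSet_shell (h𝒰 : IsOpen 𝒰) (hU : ContinuousOn U 𝒰) (b c : ℝ) :
    MeasurableSet {x ∈ 𝒰 | b ≤ U x ∧ U x ≤ c} := by
  have : {x ∈ 𝒰 | b ≤ U x ∧ U x ≤ c} = (𝒰 \ {x ∈ 𝒰 | U x < b}) \ {x ∈ 𝒰 | c < U x} := by
    ext x; simp only [Set.mem_sdiff, mem_ofPred_eq]; grind
  rw [this]
  exact (h𝒰.measurableSet.diff (isOpen_sublevel h𝒰 hU b).measurableSet).diff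
    (hU.isOpen_inter_preimage h𝒰 isOpen_Ioi).measurableSet

lemma notMem_closure_sublevel (h𝒰 : IsOpen 𝒰) (hU : ContinuousOn U 𝒰) {ρ : ℝ} {x : Eucl n}
    (hx : x ∈ 𝒰) (hρ : ρ < U x) : x ∉ closure {y ∈ 𝒰 | U y < ρ} := fun h => by
  obtain ⟨y, hy, hy'⟩ := mem_closure_iff.1 h _ (hU.isOpen_inter_preimage h𝒰 isOpen_Ioi) ⟨hx, hρ⟩
  exact lt_asymm hy.2 hy'.2

variable {a : Eucl n → Matrix (Fin n) (Fin n) ℝ} {V : Eucl n → Fin n → ℝ} {u : Eucl n → ℝ}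

/-- The tail estimate with the tail `{U ≥ ρ0}` truncated at level `c`. -/
lemma mul_integral_shell_le (h𝒰 : IsOpen 𝒰) (ha : ∀ i j, ContinuousOn (fun x => a x i j) 𝒰)
    (haU : ∀ x ∈ 𝒰, 0 ≤ aQuad a U x) (hV : ContinuousOn V 𝒰) (hu : ContinuousOn u 𝒰)
    (hu0 : ∀ x ∈ 𝒰, 0 ≤ u x) (hui : IntegrableOn u 𝒰)
    (hw : ∀ f : Eucl n → ℝ, ContDiff ℝ (⊤ : ℕ∞) f → HasCompactSupport f →
      tsupport f ⊆ 𝒰 → (∫ x in 𝒰, Lop a V f x * u x) = 0)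
    (hU : ContDiffOn ℝ 2 U 𝒰) {ρm ρ0 c d : ℝ} (hρ : ρm < ρ0) (hc : ρ0 ≤ c) (hcd : c < d)
    (hK : IsCompact {x ∈ 𝒰 | U x ≤ d}) {γ : ℝ} (hγ : 0 ≤ γ)
    (hL : ∀ x ∈ 𝒰, ρm < U x → Lop a V U x ≤ -γ) {S C : ℝ} (hS : 0 ≤ S) (hC0 : 0 ≤ C)
    (hC : ∀ t ∈ Icc ρm ρ0, deriv (ramp ρm ρ0) t ≤ C)
    (haS : ∀ x ∈ 𝒰, ρm < U x → U x < ρ0 → aQuad a U x ≤ S) :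
    γ * (∫ x in {x ∈ 𝒰 | ρ0 ≤ U x ∧ U x ≤ c}, u x) ≤
      C * S * ∫ x in {x ∈ 𝒰 | ρm ≤ U x ∧ U x < ρ0}, u x := by
  obtain ⟨φ, χ, hφ2, hφ, hχ, hφd, hχ0, hχm, hχ1, hχ'm, hχ'0, hχ'⟩ := exists_cutoff hρ hc hcd
  obtain ⟨f, hf, hfc, hfs, hfU⟩ := exists_contDiff_extend h𝒰 hU hK hφ2 hφd
  have hUc := hU.continuousOn
  set A := {x ∈ 𝒰 | ρ0 ≤ U x ∧ U x ≤ c}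
  set B := {x ∈ 𝒰 | ρm ≤ U x ∧ U x < ρ0} with hB
  have hA𝒰 : A ⊆ 𝒰 := fun x hx => hx.1
  have hB𝒰 : B ⊆ 𝒰 := fun x hx => hx.1
  have hAm : MeasurableSet A := measurableSet_shell h𝒰 hUc ρ0 c
  have hBm : MeasurableSet B := by
    have : B = {x ∈ 𝒰 | U x < ρ0} \ {x ∈ 𝒰 | U x < ρm} := by
      ext x; simp only [hB, Set.mem_sdiff, mem_ofPred_eq]; grind
    rw [this]
    exact (isOpen_sublevel h𝒰 hUc _).measurableSet.diff (isOpen_sublevel h𝒰 hUc _).measurableSet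
  have hAi : Integrable (A.indicator u) (volume.restrict 𝒰) := Integrable.indicator hui hAm
  have hBi : Integrable (B.indicator u) (volume.restrict 𝒰) := Integrable.indicator hui hBm
  have hpt : ∀ x ∈ 𝒰, Lop a V f x * u x ≤ C * S * B.indicator u x - γ * A.indicator u x := by
    intro x hx
    rw [Lop_comp h𝒰 hU a V hφ hχ hfU hx]
    have hux := hu0 x hx
    have hCS := mul_nonneg (mul_nonneg hC0 hS) hux
    have hq := haU x hx
    rcases le_or_gt (U x) ρm with h1 | h1
    · have hxA : x ∉ A := fun h => (h1.trans_lt hρ).not_ge h.2.1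
      rw [hχm _ h1, hχ'm _ h1, indicator_of_notMem hxA]
      have : 0 ≤ B.indicator u x := indicator_apply_nonneg fun _ => hux
      simpa using mul_nonneg (mul_nonneg hC0 hS) this
    have hd := mul_nonneg (hχ0 (U x)) (neg_nonneg.2 ((hL x hx h1).trans (neg_nonpos.2 hγ)))
    rcases lt_or_ge (U x) ρ0 with h2 | h2
    · have hxA : x ∉ A := fun h => h2.not_ge h.2.1
      have hxB : x ∈ B := ⟨hx, h1.le, h2⟩
      rw [indicator_of_notMem hxA, indicator_of_mem hxB, hχ'0 _ h2.le]
      have hb : deriv (ramp ρm ρ0) (U x) * aQuad a U x ≤ C * S :=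
        mul_le_mul (hC _ ⟨h1.le, h2.le⟩) (haS x hx h1 h2) hq hC0
      have : χ (U x) * Lop a V U x + deriv (ramp ρm ρ0) (U x) * aQuad a U x ≤ C * S := by
        linarith
      simpa using mul_le_mul_of_nonneg_right this hux
    · have hxB : x ∉ B := fun h => h2.not_gt h.2.2
      have hb := mul_nonpos_of_nonpos_of_nonneg (hχ' _ h2) hq
      rw [indicator_of_notMem hxB]
      rcases le_or_gt (U x) c with h3 | h3
      · rw [indicator_of_mem (show x ∈ A from ⟨hx, h2, h3⟩), hχ1 _ ⟨h2, h3⟩]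
        have := hL x hx h1
        nlinarith
      · rw [indicator_of_notMem (show x ∉ A from fun h => h3.not_ge h.2.2)]
        nlinarith
  have hint := setIntegral_mono_on (integrableOn_Lop_mul ha hV hu hf hfc hfs h𝒰.measurableSet)
    ((hBi.const_mul (C * S)).sub (hAi.const_mul γ)) h𝒰.measurableSet hpt
  rw [integral_Lop_mul_eq_zero h𝒰 ha hV hu hw hf hfc hfs,
    integral_sub' (hBi.const_mul _) (hAi.const_mul _), integral_const_mul, integral_const_mul,
    setIntegral_indicator hBm, setIntegral_indicator hAm, inter_eq_self_of_subset_right hB𝒰,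
    inter_eq_self_of_subset_right hA𝒰] at hint
  exact sub_nonneg.1 hint

lemma tendsto_integral_shell (h𝒰 : IsOpen 𝒰) (hU : ContinuousOn U 𝒰) (hui : IntegrableOn u 𝒰)
    {ρ0 : ℝ} {c : ℕ → ℝ} (hc : Monotone c) (hcU : ∀ x ∈ 𝒰, ∃ k, U x ≤ c k) :
    Tendsto (fun k => ∫ x in {x ∈ 𝒰 | ρ0 ≤ U x ∧ U x ≤ c k}, u x) atTop
      (𝓝 (∫ x in {x ∈ 𝒰 | ρ0 ≤ U x}, u x)) := by
  have hUn : {x ∈ 𝒰 | ρ0 ≤ U x} = ⋃ k, {x ∈ 𝒰 | ρ0 ≤ U x ∧ U x ≤ c k} := by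
    ext x
    simp only [mem_ofPred_eq, mem_iUnion]
    exact ⟨fun h => (hcU x h.1).imp fun k hk => ⟨h.1, h.2, hk⟩, fun ⟨k, h⟩ => ⟨h.1, h.2.1⟩⟩
  rw [hUn]
  exact tendsto_setIntegral_of_monotone (fun k => measurableSet_shell h𝒰 hU ρ0 (c k))
    (fun k l hkl x hx => ⟨hx.1, hx.2.1, hx.2.2.trans (hc hkl)⟩)
    (hui.mono_set (iUnion_subset fun k x hx => hx.1))

end TailEstimate

lemma EReal.exists_strictMono_real_seq {x : ℝ} {y : EReal} (h : (x : EReal) < y) :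
    ∃ c : ℕ → ℝ, StrictMono c ∧ (∀ k, x < c k ∧ (c k : EReal) < y) ∧
      ∀ z : ℝ, (z : EReal) < y → ∃ k, z ≤ c k := by
  obtain ⟨s, hs, hsI, hst⟩ := exists_seq_strictMono_tendsto' h
  have hcoe (k) : ((s k).toReal : EReal) = s k :=
    EReal.coe_toReal (ne_top_of_lt (hsI k).2) (ne_bot_of_gt (hsI k).1)
  refine ⟨fun k => (s k).toReal, fun k l hkl => ?_, fun k => ⟨?_, ?_⟩, fun z hz => ?_⟩
  · rw [← EReal.coe_lt_coe_iff, hcoe, hcoe]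
    exact hs hkl
  · rw [← EReal.coe_lt_coe_iff, hcoe]
    exact (hsI k).1
  · rw [hcoe]
    exact (hsI k).2
  · obtain ⟨k, hk⟩ := (hst.eventually_const_lt hz).exists
    refine ⟨k, ?_⟩
    rw [← EReal.coe_le_coe_iff, hcoe]
    exact hk.le

/-- **Theorem A(a)**: for fixed `0 < ρm < ρ0` there is a constant `C > 0`, depending only
on `ρm, ρ0`, such that for any admissible data with a Lyapunov function `U` (essential lower
bound `ρm`, essential upper bound `ρM > ρ0`, Lyapunov constant `γ`) and upper sandwich
function `H`, one has `μ(𝒰 \ Ω_{ρ0}) ≤ γ⁻¹ C (sup_{(ρm,ρ0)} H) μ(Ω_{ρ0} \ Ω_{ρm})`. -/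
theorem thmA_a :
    ∀ ρm ρ0 : ℝ, 0 < ρm → ρm < ρ0 →
    ∃ C : ℝ, 0 < C ∧
      ∀ (ρM : EReal), (ρ0 : EReal) < ρM →
      ∀ {n : ℕ}, 0 < n →
      ∀ (𝒰 : Set (Eucl n)), IsOpen 𝒰 → IsConnected 𝒰 →
      ∀ (a : Eucl n → Matrix (Fin n) (Fin n) ℝ),
        (∀ i j, ContDiffOn ℝ 1 (fun x => a x i j) 𝒰) →
        (∀ x ∈ 𝒰, ∀ i j, a x i j = a x j i) →
        (∀ x ∈ 𝒰, ∀ v : Fin n → ℝ, 0 ≤ ∑ i, ∑ j, a x i j * v i * v j) →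
      ∀ (V : Eucl n → Fin n → ℝ), ContinuousOn V 𝒰 →
      ∀ (u : Eucl n → ℝ), ContDiffOn ℝ 1 u 𝒰 → (∀ x ∈ 𝒰, 0 ≤ u x) →
        (∫ x in 𝒰, u x) = 1 →
        (∀ f : Eucl n → ℝ, ContDiff ℝ (⊤ : ℕ∞) f → HasCompactSupport f →
          tsupport f ⊆ 𝒰 → (∫ x in 𝒰, Lop a V f x * u x) = 0) →
      ∀ (U : Eucl n → ℝ), ContDiffOn ℝ 2 U 𝒰 → (∀ x ∈ 𝒰, 0 ≤ U x) →
        (∀ x ∈ 𝒰, (U x : EReal) < ρM) →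
        ρM = (⨆ x : 𝒰, (U x.1 : EReal)) →
        (∀ ρ : ℝ, (ρ : EReal) < ρM → IsCompact {x ∈ 𝒰 | U x ≤ ρ}) →
      ∀ γ : ℝ, 0 < γ →
        (∀ x ∈ 𝒰, x ∉ closure {y ∈ 𝒰 | U y < ρm} → Lop a V U x ≤ -γ) →
      ∀ (H : ℝ → ℝ), Measurable H →
        (∀ t : ℝ, 0 ≤ t → (t : EReal) < ρM → 0 ≤ H t) →
        (∀ ρ : ℝ, (ρ : EReal) < ρM → BddAbove (H '' Set.Icc 0 ρ)) →
        (∀ x ∈ 𝒰, aQuad a U x ≤ H (U x)) →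
      (∫ x in {x ∈ 𝒰 | ρ0 ≤ U x}, u x) ≤
        γ⁻¹ * C * sSup (H '' Set.Ioo ρm ρ0) *
          ∫ x in {x ∈ 𝒰 | ρm ≤ U x ∧ U x < ρ0}, u x := by
  intro ρm ρ0 hρm hρ
  obtain ⟨C, hC0, hC⟩ := exists_deriv_ramp_le (a := ρm) (b := ρ0)
  refine ⟨C, hC0, ?_⟩
  intro ρM hρM n _ 𝒰 h𝒰 _ a ha _ hpsd V hV u hu hu0 hu1 hw U hU _ hUM _ hK γ hγ hL H _ hH0 hHb hHU
  have hui : IntegrableOn u 𝒰 := by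
    by_contra h
    rw [integral_undef h] at hu1
    exact zero_ne_one hu1
  obtain ⟨c, hcm, hc, hcM⟩ := EReal.exists_strictMono_real_seq hρM
  have hIoo : ∀ t ∈ Ioo ρm ρ0, 0 ≤ t ∧ (t : EReal) < ρM := fun t ht =>
    ⟨(hρm.trans ht.1).le, (EReal.coe_lt_coe_iff.2 ht.2).trans hρM⟩
  have hS0 : 0 ≤ sSup (H '' Ioo ρm ρ0) := Real.sSup_nonneg <| by
    rintro _ ⟨t, ht, rfl⟩
    exact hH0 t (hIoo t ht).1 (hIoo t ht).2
  have hSb : BddAbove (H '' Ioo ρm ρ0) :=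
    (hHb ρ0 hρM).mono (image_mono (Ioo_subset_Icc_self.trans (Icc_subset_Icc_left hρm.le)))
  have hk (k) := mul_integral_shell_le h𝒰 (fun i j => (ha i j).continuousOn)
    (fun x hx => hpsd x hx fun i => pd U i x) hV hu.continuousOn hu0 hui hw hU hρ
    (hc k).1.le (hcm k.lt_succ_self) (hK _ (hc _).2) hγ.le
    (fun x hx h => hL x hx (notMem_closure_sublevel h𝒰 hU.continuousOn hx h)) hS0 hC0.le hC
    (fun x hx h h' => (hHU x hx).trans (le_csSup hSb ⟨U x, ⟨h, h'⟩, rfl⟩))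
  have hlim := (tendsto_integral_shell (ρ0 := ρ0) h𝒰 hU.continuousOn hui hcm.monotone
    fun x hx => hcM _ (hUM x hx)).const_mul γ
  have := le_of_tendsto' hlim hk
  rwa [mul_assoc γ⁻¹, mul_assoc γ⁻¹, le_inv_mul_iff₀ hγ]
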